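/- arXiv:alg-geom/9601010 — 2 statements merged into one kernel-verified Lean document; each statement's English description precedes it below -/
import Mathlib

section
/- Let R be a commutative ring and let φ be a morphism of two-term complexes of R-modules from (d_E : E⁰ → E¹) to (d_F : F⁰ → F¹), given by R-linear maps φ⁰ : E⁰ → F⁰ and φ¹ : E¹ → F¹ satisfying φ¹ ∘ d_E = d_F ∘ φ⁰. If φ is a quasi-isomorphism, i.e. the induced maps ker d_E → ker d_F and coker d_E → coker d_F are both bijective, then the map E⁰ → E¹ × F⁰ sending e to (d_E e, φ⁰ e) is a bijection from E⁰ onto the fiber product {(x, y) ∈ E¹ × F⁰ : φ¹ x = d_F y}. -/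
/-- Let `R` be a commutative ring and `φ = (φ⁰, φ¹)` a morphism of two-term complexes of
`R`-modules from `(d_E : E⁰ → E¹)` to `(d_F : F⁰ → F¹)`.  If `φ` is a quasi-isomorphism,
i.e. the induced maps `ker d_E → ker d_F` and `coker d_E → coker d_F` are bijective,
then the map `E⁰ → E¹ × F⁰`, `e ↦ (d_E e, φ⁰ e)`, is a bijection from `E⁰` onto the
fiber product `{(x, y) ∈ E¹ × F⁰ : φ¹ x = d_F y}`. -/
theorem quasiIso_induces_iso_on_fiber_product
    {R E0 E1 F0 F1 : Type*} [CommRing R]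
    [AddCommGroup E0] [Module R E0] [AddCommGroup E1] [Module R E1]
    [AddCommGroup F0] [Module R F0] [AddCommGroup F1] [Module R F1]
    (dE : E0 →ₗ[R] E1) (dF : F0 →ₗ[R] F1)
    (φ0 : E0 →ₗ[R] F0) (φ1 : E1 →ₗ[R] F1)
    (hcomm : ∀ e : E0, φ1 (dE e) = dF (φ0 e))
    (hker : Function.Bijective
      (fun x : LinearMap.ker dE =>
        (⟨φ0 x, by
          have hx : dE (x : E0) = 0 := x.2
          simp [LinearMap.mem_ker, ← hcomm, hx]⟩ : LinearMap.ker dF)))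
    (hcoker : Function.Bijective
      (Submodule.mapQ (LinearMap.range dE) (LinearMap.range dF) φ1
        (by
          rintro _ ⟨e, rfl⟩
          exact ⟨φ0 e, (hcomm e).symm⟩))) :
    Function.Bijective
      (fun e : E0 =>
        (⟨(dE e, φ0 e), hcomm e⟩ : {p : E1 × F0 // φ1 p.1 = dF p.2})) := by
  constructor
  · intro a b hab
    obtain ⟨hd, hφ⟩ := Prod.mk.inj (Subtype.mk.inj hab)
    have hmem : a - b ∈ LinearMap.ker dE := by simp [LinearMap.mem_ker, hd]
    have h0 : (⟨a - b, hmem⟩ : LinearMap.ker dE) = 0 :=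
      hker.1 (Subtype.ext (by simp [hφ]))
    exact sub_eq_zero.1 (congrArg Subtype.val h0)
  · rintro ⟨⟨x, y⟩, hxy⟩
    have hx : x ∈ LinearMap.range dE := by
      rw [← Submodule.Quotient.mk_eq_zero]
      apply hcoker.1
      rw [map_zero, Submodule.mapQ_apply, Submodule.Quotient.mk_eq_zero]
      exact ⟨y, hxy.symm⟩
    obtain ⟨e, rfl⟩ := hx
    have hmem : y - φ0 e ∈ LinearMap.ker dF := by
      rw [LinearMap.mem_ker, map_sub, ← hcomm, sub_eq_zero]
      exact hxy.symm
    obtain ⟨⟨k, hk⟩, hky⟩ := hker.2 ⟨y - φ0 e, hmem⟩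
    have hφk : φ0 k = y - φ0 e := congrArg Subtype.val hky
    refine ⟨e + k, Subtype.ext (Prod.ext ?_ ?_)⟩
    · simp [LinearMap.mem_ker.1 hk]
    · simp [hφk]
end

section
/- Let R be a commutative ring and let φ be a morphism of two-term complexes of R-modules from (d_E : E⁻¹ → E⁰) to (d_L : L⁻¹ → L⁰), given by R-linear maps φ⁻¹ : E⁻¹ → L⁻¹ and φ⁰ : E⁰ → L⁰ with φ⁰ ∘ d_E = d_L ∘ φ⁻¹. Let F = {(x, y) ∈ E⁰ × L⁻¹ : φ⁰ x = d_L y} be the fiber product and let u : E⁻¹ → F be the map e ↦ (d_E e, φ⁻¹ e). Then u is surjective if and only if the induced map coker d_E → coker d_L is injective and the induced map ker d_E → ker d_L is surjective. -/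
/-- Let `φ = (φ⁻¹, φ⁰)` be a morphism of two-term complexes of `R`-modules from
`(d_E : E⁻¹ → E⁰)` to `(d_L : L⁻¹ → L⁰)`.  Let
`F = {(x, y) ∈ E⁰ × L⁻¹ : φ⁰ x = d_L y}` and `u : E⁻¹ → F`, `e ↦ (d_E e, φ⁻¹ e)`.
Then `u` is surjective if and only if the induced map `coker d_E → coker d_L` is
injective and the induced map `ker d_E → ker d_L` is surjective. -/
theorem surjective_onto_fiber_product_iff
    {R Em1 E0 Lm1 L0 : Type*} [CommRing R]
    [AddCommGroup Em1] [Module R Em1] [AddCommGroup E0] [Module R E0]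
    [AddCommGroup Lm1] [Module R Lm1] [AddCommGroup L0] [Module R L0]
    (dE : Em1 →ₗ[R] E0) (dL : Lm1 →ₗ[R] L0)
    (φm1 : Em1 →ₗ[R] Lm1) (φ0 : E0 →ₗ[R] L0)
    (hcomm : ∀ e : Em1, φ0 (dE e) = dL (φm1 e)) :
    Function.Surjective
        (fun e : Em1 =>
          (⟨(dE e, φm1 e), hcomm e⟩ : {p : E0 × Lm1 // φ0 p.1 = dL p.2})) ↔
      (Function.Injective
          (Submodule.mapQ (LinearMap.range dE) (LinearMap.range dL) φ0
            (by
              rintro _ ⟨e, rfl⟩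
              exact ⟨φm1 e, (hcomm e).symm⟩)) ∧
       Function.Surjective
          (fun x : LinearMap.ker dE =>
            (⟨φm1 x, by
              have hx : dE (x : Em1) = 0 := x.2
              simp [LinearMap.mem_ker, ← hcomm, hx]⟩ : LinearMap.ker dL))) := by
  constructor
  · intro h
    refine ⟨(injective_iff_map_eq_zero _).2 fun q hq => ?_, fun ⟨y, hy⟩ => ?_⟩
    · obtain ⟨x, rfl⟩ := Submodule.Quotient.mk_surjective _ q
      rw [Submodule.mapQ_apply, Submodule.Quotient.mk_eq_zero] at hq
      obtain ⟨y, hy⟩ := hq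
      obtain ⟨e, he⟩ := h ⟨(x, y), hy.symm⟩
      exact (Submodule.Quotient.mk_eq_zero _).2 ⟨e, congrArg (fun p => p.1.1) he⟩
    · obtain ⟨e, he⟩ := h ⟨(0, y), by
        rw [map_zero]
        exact (LinearMap.mem_ker.1 hy).symm⟩
      exact ⟨⟨e, LinearMap.mem_ker.2 (congrArg (fun p => p.1.1) he)⟩,
        Subtype.ext (congrArg (fun p => p.1.2) he)⟩
  · rintro ⟨hinj, hsurj⟩ ⟨⟨x, y⟩, hxy⟩
    obtain ⟨e, rfl⟩ : x ∈ LinearMap.range dE := by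
      rw [← Submodule.Quotient.mk_eq_zero]
      apply (injective_iff_map_eq_zero _).1 hinj
      rw [Submodule.mapQ_apply, Submodule.Quotient.mk_eq_zero]
      exact ⟨y, hxy.symm⟩
    have hy : y - φm1 e ∈ LinearMap.ker dL := by
      rw [LinearMap.mem_ker, map_sub, ← hcomm, sub_eq_zero]
      exact hxy.symm
    obtain ⟨⟨k, hk⟩, hke⟩ := hsurj ⟨y - φm1 e, hy⟩
    have hk' : φm1 k = y - φm1 e := congrArg Subtype.val hke
    refine ⟨e + k, Subtype.ext (Prod.ext ?_ ?_)⟩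
    · simp [LinearMap.mem_ker.1 hk]
    · simp [hk']
end
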